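/- arXiv:2007.07639 — 3 statements merged into one kernel-verified Lean document; each statement's English description precedes it below -/
import Mathlib

section
/- For 0 < u < 1 and any initial vector p⁰ ∈ ℝⁿ, the solution p(t) = (u/n)(I - exp(-tQ)) Q⁻¹ 1_n + exp(-tQ) p⁰ of the continuous-time Page Rank diffusion equation converges as t → ∞ to the stationary vector p* = (u/n) Q⁻¹ 1_n; the dynamics forgets the initial conditions. -/
open Matrix

theorem norm_normedSpace_exp_le {𝔸 : Type*} [NormedRing 𝔸] [NormedAlgebra ℝ 𝔸]
    [NormOneClass 𝔸] [CompleteSpace 𝔸] (x : 𝔸) :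
    ‖NormedSpace.exp x‖ ≤ Real.exp ‖x‖ := by
  rw [NormedSpace.exp_eq_tsum ℝ, Real.exp_eq_exp_ℝ, NormedSpace.exp_eq_tsum ℝ]
  refine tsum_of_norm_bounded (NormedSpace.expSeries_summable' (𝕂 := ℝ) ‖x‖).hasSum fun k => ?_
  rw [norm_smul, norm_inv, RCLike.norm_natCast, smul_eq_mul]
  gcongr
  exact norm_pow_le x k

theorem tendsto_exp_neg_smul_one_sub {𝔸 : Type*} [NormedRing 𝔸] [NormedAlgebra ℝ 𝔸]
    [NormOneClass 𝔸] [CompleteSpace 𝔸] (M : 𝔸) (hM : ‖M‖ < 1) :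
    Filter.Tendsto (fun t : ℝ => NormedSpace.exp (-(t • (1 - M)))) Filter.atTop (nhds 0) := by
  have key (t : ℝ) (ht : 0 ≤ t) :
      ‖NormedSpace.exp (-(t • (1 - M)))‖ ≤ Real.exp (-(t * (1 - ‖M‖))) := by
    let : NormedAlgebra ℚ 𝔸 := NormedAlgebra.restrictScalars ℚ ℝ 𝔸
    have hsplit : -(t • (1 - M)) = algebraMap ℝ 𝔸 (-t) + t • M := by
      rw [Algebra.algebraMap_eq_smul_one, smul_sub, neg_smul]
      abel
    rw [hsplit, NormedSpace.exp_add_of_commute (Algebra.commutes (-t) (t • M)),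
      ← NormedSpace.algebraMap_exp_comm, ← Real.exp_eq_exp_ℝ]
    calc ‖algebraMap ℝ 𝔸 (Real.exp (-t)) * NormedSpace.exp (t • M)‖
        ≤ Real.exp (-t) * Real.exp (t * ‖M‖) := by
          refine (norm_mul_le _ _).trans ?_
          rw [norm_algebraMap', Real.norm_of_nonneg (Real.exp_nonneg _)]
          gcongr
          refine (norm_normedSpace_exp_le _).trans_eq ?_
          rw [norm_smul, Real.norm_of_nonneg ht]
      _ = Real.exp (-(t * (1 - ‖M‖))) := by
          rw [← Real.exp_add]
          ring_nf
  refine squeeze_zero_norm' ((Filter.eventually_ge_atTop 0).mono key) ?_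
  exact Real.tendsto_exp_neg_atTop_nhds_zero.comp
    (Filter.tendsto_id.atTop_mul_const (sub_pos.2 hM))

theorem Matrix.tendsto_exp_neg_smul_one_sub {n : Type*} [Fintype n] [DecidableEq n] [Nonempty n]
    (M : Matrix n n ℝ) (hM : ∀ i, ∑ j, |M i j| < 1) :
    Filter.Tendsto (fun t : ℝ => NormedSpace.exp (-(t • (1 - M)))) Filter.atTop (nhds 0) := by
  let : NormedRing (Matrix n n ℝ) := Matrix.linftyOpNormedRing
  let : NormedAlgebra ℝ (Matrix n n ℝ) := Matrix.linftyOpNormedAlgebra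
  have : NormOneClass (Matrix n n ℝ) := Matrix.linfty_opNormOneClass
  have : CompleteSpace (Matrix n n ℝ) := FiniteDimensional.complete ℝ _
  have hnorm : ‖M‖ < 1 := by
    have h : ‖M‖₊ < 1 := by
      refine (Matrix.linfty_opNNNorm_def M).trans_lt ?_
      refine (Finset.sup_lt_iff (by simp)).2 fun i _ => ?_
      rw [← NNReal.coe_lt_coe]
      simpa using hM i
    exact_mod_cast h
  exact _root_.tendsto_exp_neg_smul_one_sub M hnorm

/-- For `0 < u < 1` and any initial vector `p⁰`, the solution
`p t = (u/n)(I - exp(-tQ)) Q⁻¹ 1 + exp(-tQ) p⁰` of the continuous-time Page Rank diffusion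
equation converges as `t → ∞` to the stationary vector `p* = (u/n) Q⁻¹ 1`: the dynamics
forgets the initial conditions. -/
theorem pagerank_diffusion_tendsto_stationary
    (n : ℕ) (hn : 1 ≤ n) (A : Matrix (Fin n) (Fin n) ℝ)
    (hsymm : ∀ i j, A i j = A j i)
    (h01 : ∀ i j, A i j = 0 ∨ A i j = 1)
    (hdiag : ∀ i, A i i = 0)
    (hdeg : ∀ i, 0 < ∑ j, A i j)
    (W : Matrix (Fin n) (Fin n) ℝ)
    (hW : ∀ i j, W i j = A i j / ∑ k, A i k)
    (u : ℝ) (hu0 : 0 < u) (hu1 : u < 1)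
    (Q : Matrix (Fin n) (Fin n) ℝ)
    (hQ : Q = 1 - (1 - u) • Wᵀ)
    (hQunit : IsUnit Q)
    (p0 : Fin n → ℝ)
    (p : ℝ → Fin n → ℝ)
    (hp : ∀ t, p t = (u / n) • ((1 - NormedSpace.exp (-(t • Q))).mulVec (Q⁻¹.mulVec 1))
        + (NormedSpace.exp (-(t • Q))).mulVec p0)
    (pstar : Fin n → ℝ)
    (hpstar : pstar = (u / n) • Q⁻¹.mulVec 1) :
    Filter.Tendsto p Filter.atTop (nhds pstar) := by
  have : Nonempty (Fin n) := ⟨⟨0, hn⟩⟩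
  have hA (i j) : 0 ≤ A i j := by rcases h01 i j with h | h <;> simp [h]
  have hrow (i) : ∑ j, |((1 - u) • W) i j| < 1 := by
    have h (j) : |((1 - u) • W) i j| = (1 - u) * (A i j / ∑ k, A i k) := by
      rw [Matrix.smul_apply, hW, smul_eq_mul, abs_of_nonneg]
      exact mul_nonneg (by linarith) (div_nonneg (hA i j) (hdeg i).le)
    simp_rw [h]
    rw [← Finset.mul_sum, ← Finset.sum_div, div_self (hdeg i).ne']
    linarith
  have hexp : Filter.Tendsto (fun t : ℝ => NormedSpace.exp (-(t • Q))) Filter.atTop (nhds 0) := by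
    have hT (t : ℝ) : NormedSpace.exp (-(t • Q))
        = (NormedSpace.exp (-(t • (1 - (1 - u) • W))))ᵀ := by
      rw [← Matrix.exp_transpose, hQ]
      simp
    simp_rw [hT]
    have h := ((continuous_id.matrix_transpose).tendsto (0 : Matrix (Fin n) (Fin n) ℝ)).comp
      (Matrix.tendsto_exp_neg_smul_one_sub _ hrow)
    simpa [Function.comp_def] using h
  have hcont : Continuous fun E : Matrix (Fin n) (Fin n) ℝ =>
      (u / n) • ((1 - E).mulVec (Q⁻¹.mulVec 1)) + E.mulVec p0 := by
    fun_prop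
  have h := (hcont.tendsto 0).comp hexp
  rw [funext hp, hpstar]
  simpa [Function.comp_def] using h
end

section
/- For every t ≥ 0 and every u with 0 ≤ u ≤ 1, all entries of the matrix exp(-tQ) are nonnegative; consequently, if the initial vector p⁰ has nonnegative entries, the solution p(t) = (u/n)(I - exp(-tQ)) Q⁻¹ 1_n + exp(-tQ) p⁰ of the Page Rank diffusion equation has nonnegative entries for all t ≥ 0. -/
open Matrix

namespace Matrix

variable {m : Type*} [Fintype m]

theorem mulVec_apply_nonneg {B : Matrix m m ℝ} (hB : ∀ i j, 0 ≤ B i j) {v : m → ℝ}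
    (hv : ∀ i, 0 ≤ v i) (i : m) : 0 ≤ (B *ᵥ v) i :=
  Finset.sum_nonneg fun j _ => mul_nonneg (hB i j) (hv j)

variable [DecidableEq m]

open scoped Matrix.Norms.Operator in
theorem exp_apply_nonneg {B : Matrix m m ℝ} (hB : ∀ i j, 0 ≤ B i j) (i j : m) :
    0 ≤ NormedSpace.exp B i j := by
  have h : HasSum (fun k : ℕ => ((k.factorial : ℝ)⁻¹ • B ^ k)) (NormedSpace.exp B) :=
    NormedSpace.exp_series_hasSum_exp' (𝕂 := ℝ) B
  have hij := Pi.hasSum.mp (Pi.hasSum.mp h i) j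
  refine hij.nonneg fun k => ?_
  exact mul_nonneg (by positivity) (pow_apply_nonneg hB k i j)

theorem exp_smul_one (c : ℝ) :
    NormedSpace.exp (c • (1 : Matrix m m ℝ)) = Real.exp c • (1 : Matrix m m ℝ) := by
  rw [smul_one_eq_diagonal, exp_diagonal, smul_one_eq_diagonal]
  congr 1
  ext i
  rw [Pi.coe_exp, Real.exp_eq_exp_ℝ]

/-- The exponential of a matrix which is entrywise nonnegative up to a shift by a scalar matrix is
entrywise nonnegative. -/
theorem exp_add_smul_one_apply_nonneg {B : Matrix m m ℝ} (hB : ∀ i j, 0 ≤ B i j) (c : ℝ)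
    (i j : m) : 0 ≤ NormedSpace.exp (B + c • (1 : Matrix m m ℝ)) i j := by
  rw [exp_add_of_commute _ _ ((Commute.one_right B).smul_right c), exp_smul_one,
    Matrix.mul_smul, Matrix.mul_one, smul_apply]
  exact mul_nonneg (Real.exp_pos c).le (exp_apply_nonneg hB i j)

open scoped Matrix.Norms.Operator in
theorem hasDerivAt_exp_neg_smul_mulVec_apply (Q : Matrix m m ℝ) (v : m → ℝ) (i : m) (t : ℝ) :
    HasDerivAt (fun s : ℝ => (NormedSpace.exp (-(s • Q)) *ᵥ v) i)
      (-(NormedSpace.exp (-(t • Q)) *ᵥ (Q *ᵥ v)) i) t := by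
  have h : HasDerivAt (fun s : ℝ => NormedSpace.exp (s • -Q))
      (NormedSpace.exp (t • -Q) * -Q) t := hasDerivAt_exp_smul_const (𝕂 := ℝ) (-Q) t
  let L : Matrix m m ℝ →ₗ[ℝ] ℝ := LinearMap.proj i ∘ₗ (mulVecBilin ℝ ℝ).flip v
  have hL : HasDerivAt (fun s : ℝ => (NormedSpace.exp (s • -Q) *ᵥ v) i)
      (((NormedSpace.exp (t • -Q) * -Q) *ᵥ v) i) t :=
    L.toContinuousLinearMap.hasFDerivAt.comp_hasDerivAt t h
  simpa [mulVec_mulVec, neg_mulVec] using hL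

/-- The Duhamel term `(1 - exp (-tQ)) Q⁻¹ v` is nonnegative when `v` and the semigroup `exp (-sQ)`
are. For singular `Q` it vanishes, as then `Q⁻¹ = 0`. -/
theorem one_sub_exp_mulVec_inv_mulVec_apply_nonneg {Q : Matrix m m ℝ}
    (hQ : ∀ s : ℝ, 0 ≤ s → ∀ i j, 0 ≤ NormedSpace.exp (-(s • Q)) i j) {v : m → ℝ}
    (hv : ∀ i, 0 ≤ v i) {t : ℝ} (ht : 0 ≤ t) (i : m) :
    0 ≤ ((1 - NormedSpace.exp (-(t • Q))) *ᵥ (Q⁻¹ *ᵥ v)) i := by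
  by_cases hdet : IsUnit Q.det
  · have hd := fun s => hasDerivAt_exp_neg_smul_mulVec_apply Q (Q⁻¹ *ᵥ v) i s
    simp only [mulVec_mulVec v Q, mul_nonsing_inv Q hdet, one_mulVec] at hd
    have hanti : AntitoneOn (fun s : ℝ => (NormedSpace.exp (-(s • Q)) *ᵥ (Q⁻¹ *ᵥ v)) i)
        (Set.Ici 0) := by
      refine antitoneOn_of_deriv_nonpos (convex_Ici 0)
        (fun s _ => (hd s).continuousAt.continuousWithinAt)
        (fun s _ => (hd s).differentiableAt.differentiableWithinAt) fun s hs => ?_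
      rw [(hd s).deriv]
      rw [interior_Ici] at hs
      exact neg_nonpos.mpr (mulVec_apply_nonneg (hQ s hs.le) hv i)
    have h0 := hanti Set.self_mem_Ici ht ht
    simp only [zero_smul, neg_zero, NormedSpace.exp_zero, one_mulVec] at h0
    rw [sub_mulVec, one_mulVec, Pi.sub_apply]
    exact sub_nonneg.mpr h0
  · simp [nonsing_inv_apply_not_isUnit Q hdet]

end Matrix

/-- For `t ≥ 0` and `0 ≤ u ≤ 1`, all entries of `exp(-tQ)` are nonnegative; consequently,
if the initial vector `p⁰` is componentwise nonnegative, then the solution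
`p t = (u/n)(I - exp(-tQ)) Q⁻¹ 1 + exp(-tQ) p⁰` of the Page Rank diffusion equation is
componentwise nonnegative for all `t ≥ 0`. -/
theorem pagerank_diffusion_nonneg
    (n : ℕ) (hn : 1 ≤ n) (A : Matrix (Fin n) (Fin n) ℝ)
    (hsymm : ∀ i j, A i j = A j i)
    (h01 : ∀ i j, A i j = 0 ∨ A i j = 1)
    (hdiag : ∀ i, A i i = 0)
    (hdeg : ∀ i, 0 < ∑ j, A i j)
    (W : Matrix (Fin n) (Fin n) ℝ)
    (hW : ∀ i j, W i j = A i j / ∑ k, A i k)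
    (u : ℝ) (hu0 : 0 ≤ u) (hu1 : u ≤ 1)
    (Q : Matrix (Fin n) (Fin n) ℝ)
    (hQ : Q = 1 - (1 - u) • Wᵀ)
    (p0 : Fin n → ℝ) (hp0 : ∀ i, 0 ≤ p0 i)
    (p : ℝ → Fin n → ℝ)
    (hp : ∀ t, p t = (u / n) • ((1 - NormedSpace.exp (-(t • Q))).mulVec (Q⁻¹.mulVec 1))
        + (NormedSpace.exp (-(t • Q))).mulVec p0) :
    ∀ t : ℝ, 0 ≤ t →
      (∀ i j, 0 ≤ (NormedSpace.exp (-(t • Q))) i j) ∧ (∀ i, 0 ≤ p t i) := by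
  have hW0 : ∀ i j, 0 ≤ W i j := fun i j => by
    rw [hW]
    refine div_nonneg ?_ (hdeg i).le
    rcases h01 i j with h | h <;> simp [h]
  have hexp : ∀ t : ℝ, 0 ≤ t → ∀ i j, 0 ≤ NormedSpace.exp (-(t • Q)) i j := by
    intro t ht i j
    have hsplit : -(t • Q) = (t * (1 - u)) • Wᵀ + (-t) • (1 : Matrix (Fin n) (Fin n) ℝ) := by
      rw [hQ, smul_sub, smul_smul, neg_smul]
      abel
    rw [hsplit]
    exact exp_add_smul_one_apply_nonneg
      (fun i j => mul_nonneg (mul_nonneg ht (sub_nonneg.mpr hu1)) (hW0 j i)) _ i j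
  refine fun t ht => ⟨hexp t ht, fun i => ?_⟩
  rw [hp]
  exact add_nonneg
    (mul_nonneg (div_nonneg hu0 n.cast_nonneg)
      (one_sub_exp_mulVec_inv_mulVec_apply_nonneg hexp (fun _ => zero_le_one) ht i))
    (mulVec_apply_nonneg (hexp t ht) hp0 i)
end

section
/- For 0 < u < 1, the average transit time ⟨T⟩ := Σ_i ∫₀^∞ [ (exp(-tQ))_{ii} - (u/n)(exp(-tQ) Q⁻¹ 1_n)_i ] dt is finite and equals trace(Q⁻¹) - 1/u. -/
open Matrix

section BanachAlgebra

open NormedSpace MeasureTheory Filter Set Topology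

variable {𝔸 : Type*} [NormedRing 𝔸] [NormedAlgebra ℝ 𝔸] [CompleteSpace 𝔸]

theorem norm_exp_le_exp_norm [NormOneClass 𝔸] (x : 𝔸) : ‖exp x‖ ≤ Real.exp ‖x‖ := by
  have hreal : HasSum (fun k : ℕ => ((k.factorial : ℝ)⁻¹) * ‖x‖ ^ k) (Real.exp ‖x‖) := by
    simpa [Real.exp_eq_exp_ℝ] using exp_series_hasSum_exp' (𝕂 := ℝ) ‖x‖
  rw [← (exp_series_hasSum_exp' (𝕂 := ℝ) x).tsum_eq]
  refine tsum_of_norm_bounded hreal fun k => ?_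
  rw [norm_smul, Real.norm_of_nonneg (by positivity)]
  gcongr
  exact norm_pow_le x k

theorem norm_exp_neg_smul_one_sub_le [NormOneClass 𝔸] (x : 𝔸) {t : ℝ} (ht : 0 ≤ t) :
    ‖exp (-(t • (1 - x)))‖ ≤ Real.exp (-(1 - ‖x‖) * t) := by
  have hsplit : exp (-(t • (1 - x))) = Real.exp (-t) • exp (t • x) := by
    have hcomm : Commute (algebraMap ℝ 𝔸 (-t)) (t • x) := Algebra.commutes _ _
    let : NormedAlgebra ℚ 𝔸 := .restrictScalars ℚ ℝ 𝔸
    have harg : -(t • (1 - x)) = algebraMap ℝ 𝔸 (-t) + t • x := by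
      rw [Algebra.algebraMap_eq_smul_one, smul_sub, neg_smul]; abel
    rw [harg, exp_add_of_commute hcomm, ← algebraMap_exp_comm (𝕂 := ℝ),
      Algebra.smul_def (Real.exp (-t)), Real.exp_eq_exp_ℝ]
  rw [hsplit, norm_smul, Real.norm_of_nonneg (Real.exp_pos _).le]
  calc Real.exp (-t) * ‖exp (t • x)‖ ≤ Real.exp (-t) * Real.exp ‖t • x‖ := by
        gcongr; exact norm_exp_le_exp_norm _
    _ = Real.exp (-(1 - ‖x‖) * t) := by
        rw [← Real.exp_add, norm_smul, Real.norm_of_nonneg ht]; ring_nf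

theorem hasDerivAt_exp_neg_smul (q : 𝔸) (t : ℝ) :
    HasDerivAt (fun s : ℝ => exp (-(s • q))) (-(exp (-(t • q)) * q)) t := by
  simpa using hasDerivAt_exp_smul_const (𝕂 := ℝ) (-q) t

theorem integrableOn_exp_neg_smul_one_sub [NormOneClass 𝔸] {x : 𝔸} (hx : ‖x‖ < 1) :
    IntegrableOn (fun t : ℝ => exp (-(t • (1 - x)))) (Ioi 0) := by
  have hcont : Continuous fun t : ℝ => exp (-(t • (1 - x))) :=
    continuous_iff_continuousAt.2 fun t => (hasDerivAt_exp_neg_smul _ t).continuousAt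
  refine (exp_neg_integrableOn_Ioi 0 (sub_pos.2 hx)).mono' hcont.aestronglyMeasurable ?_
  filter_upwards [ae_restrict_mem measurableSet_Ioi] with t ht
  exact norm_exp_neg_smul_one_sub_le x (le_of_lt ht)

theorem integral_exp_neg_smul_one_sub [NormOneClass 𝔸] {x r : 𝔸} (hx : ‖x‖ < 1)
    (hr : (1 - x) * r = 1) :
    ∫ t in Ioi (0 : ℝ), exp (-(t • (1 - x))) = r := by
  have hderiv (t : ℝ) :
      HasDerivAt (fun s : ℝ => -(exp (-(s • (1 - x))) * r)) (exp (-(t • (1 - x)))) t := by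
    have h := ((hasDerivAt_exp_neg_smul (1 - x) t).mul_const r).fun_neg
    rwa [neg_mul, neg_neg, mul_assoc, hr, mul_one] at h
  have hexp : Tendsto (fun t : ℝ => exp (-(t • (1 - x)))) atTop (𝓝 0) := by
    refine squeeze_zero_norm' ((eventually_ge_atTop 0).mono fun t ht =>
      norm_exp_neg_smul_one_sub_le x ht) ?_
    exact Real.tendsto_exp_atBot.comp
      (tendsto_id.const_mul_atTop_of_neg (neg_neg_of_pos (sub_pos.2 hx)))
  have hlim : Tendsto (fun t : ℝ => -(exp (-(t • (1 - x))) * r)) atTop (𝓝 0) := by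
    simpa using (hexp.mul_const r).neg
  simpa using integral_Ioi_of_hasDerivAt_of_tendsto' (fun t _ => hderiv t)
    (integrableOn_exp_neg_smul_one_sub hx) hlim

end BanachAlgebra

section Stochastic

variable {m : Type*} [Fintype m] [DecidableEq m]

open scoped Matrix.Norms.Operator in
theorem Matrix.linfty_opNorm_le_of_row_sum_eq_one {W : Matrix m m ℝ} (hnonneg : ∀ i j, 0 ≤ W i j)
    (hrow : ∀ i, ∑ j, W i j = 1) : ‖W‖ ≤ 1 := by
  rw [linfty_opNorm_def, ← NNReal.coe_one, NNReal.coe_le_coe]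
  refine Finset.sup_le fun i _ => ?_
  rw [← NNReal.coe_le_coe]
  push_cast
  rw [← hrow i]
  exact (Finset.sum_congr rfl fun j _ => Real.norm_of_nonneg (hnonneg i j)).le

open scoped Matrix.Norms.Operator in
/-- For a row-stochastic matrix `W` and `0 < u < 1`, linear functionals of the semigroup generated
by `-(1 - (1 - u) • Wᵀ)` are integrable, with integral given by the resolvent. -/
theorem Matrix.integral_linearMap_exp_neg_smul_one_sub_transpose [Nonempty m] {W : Matrix m m ℝ}
    (hnonneg : ∀ i j, 0 ≤ W i j) (hrow : ∀ i, ∑ j, W i j = 1) {u : ℝ} (hu0 : 0 < u) (hu1 : u < 1)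
    {Q : Matrix m m ℝ} (hQ : Q = 1 - (1 - u) • Wᵀ) (hQunit : IsUnit Q)
    (L : Matrix m m ℝ →ₗ[ℝ] ℝ) :
    MeasureTheory.IntegrableOn (fun t : ℝ => L (NormedSpace.exp (-(t • Q)))) (Set.Ioi 0) ∧
      ∫ t in Set.Ioi (0 : ℝ), L (NormedSpace.exp (-(t • Q))) = L Q⁻¹ := by
  have hx : ‖(1 - u) • W‖ < 1 := by
    rw [norm_smul, Real.norm_of_nonneg (by linarith)]
    nlinarith [linfty_opNorm_le_of_row_sum_eq_one hnonneg hrow]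
  have hQt : Qᵀ = 1 - (1 - u) • W := by simp [hQ]
  have hr : (1 - (1 - u) • W) * (Q⁻¹)ᵀ = 1 := by
    rw [← hQt, ← transpose_mul, nonsing_inv_mul _ ((isUnit_iff_isUnit_det _).1 hQunit),
      transpose_one]
  let Lt : Matrix m m ℝ →L[ℝ] ℝ :=
    LinearMap.toContinuousLinearMap (L ∘ₗ (transposeLinearEquiv m m ℝ ℝ).toLinearMap)
  have hLt (M : Matrix m m ℝ) : Lt M = L Mᵀ := rfl
  have hexp (t : ℝ) : L (NormedSpace.exp (-(t • Q))) =
      Lt (NormedSpace.exp (-(t • (1 - (1 - u) • W)))) := by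
    rw [hLt, ← exp_transpose, ← hQt]; simp
  have hint := integrableOn_exp_neg_smul_one_sub hx
  simp_rw [hexp]
  refine ⟨Lt.integrable_comp hint, (Lt.integral_comp_comm hint).trans ?_⟩
  rw [integral_exp_neg_smul_one_sub hx hr]
  exact (hLt _).trans (by rw [transpose_transpose])

end Stochastic

/-- For `0 < u < 1`, the average transit time
`⟨T⟩ = ∑ i ∫₀^∞ [ (exp(-tQ))_{ii} - (u/n)(exp(-tQ) Q⁻¹ 1)_i ] dt` is finite (each integrand
is integrable on `(0,∞)`) and equals `trace(Q⁻¹) - 1/u`. -/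
theorem pagerank_average_transit_time
    (n : ℕ) (hn : 1 ≤ n) (A : Matrix (Fin n) (Fin n) ℝ)
    (hsymm : ∀ i j, A i j = A j i)
    (h01 : ∀ i j, A i j = 0 ∨ A i j = 1)
    (hdiag : ∀ i, A i i = 0)
    (hdeg : ∀ i, 0 < ∑ j, A i j)
    (W : Matrix (Fin n) (Fin n) ℝ)
    (hW : ∀ i j, W i j = A i j / ∑ k, A i k)
    (u : ℝ) (hu0 : 0 < u) (hu1 : u < 1)
    (Q : Matrix (Fin n) (Fin n) ℝ)
    (hQ : Q = 1 - (1 - u) • Wᵀ)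
    (hQunit : IsUnit Q) :
    (∀ i, MeasureTheory.IntegrableOn
        (fun t : ℝ => (NormedSpace.exp (-(t • Q))) i i
          - (u / n) * ((NormedSpace.exp (-(t • Q))).mulVec (Q⁻¹.mulVec 1)) i)
        (Set.Ioi 0))
    ∧ ∑ i, ∫ t in Set.Ioi (0 : ℝ),
        ((NormedSpace.exp (-(t • Q))) i i
          - (u / n) * ((NormedSpace.exp (-(t • Q))).mulVec (Q⁻¹.mulVec 1)) i)
      = Q⁻¹.trace - 1 / u := by
  have : Nonempty (Fin n) := ⟨⟨0, hn⟩⟩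
  have hnonneg (i j) : 0 ≤ W i j := by
    rw [hW]
    exact div_nonneg (by rcases h01 i j with h | h <;> simp [h]) (hdeg i).le
  have hrow (i) : ∑ j, W i j = 1 := by
    simp_rw [hW, ← Finset.sum_div]
    exact div_self (hdeg i).ne'
  let w : Fin n → ℝ := Q⁻¹ *ᵥ 1
  let L (i : Fin n) : Matrix (Fin n) (Fin n) ℝ →ₗ[ℝ] ℝ :=
    { toFun := fun M => M i i - (u / n) * (M *ᵥ w) i
      map_add' := fun M N => by simp only [add_mulVec, Pi.add_apply, Matrix.add_apply]; ring
      map_smul' := fun c M => by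
        simp only [smul_mulVec, Pi.smul_apply, Matrix.smul_apply, smul_eq_mul, RingHom.id_apply]
        ring }
  have key (i : Fin n) :=
    integral_linearMap_exp_neg_smul_one_sub_transpose hnonneg hrow hu0 hu1 hQ hQunit (L i)
  refine ⟨fun i => (key i).1, (Finset.sum_congr rfl fun i _ => (key i).2).trans ?_⟩
  have hdet := (isUnit_iff_isUnit_det _).1 hQunit
  have hcol : 1 ᵥ* Q = u • (1 : Fin n → ℝ) := by
    ext j
    simp [hQ, vecMul_sub, vecMul_smul, vecMul_transpose, mulVec, dotProduct, hrow]
  have hinv : 1 ᵥ* Q⁻¹ = u⁻¹ • (1 : Fin n → ℝ) := by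
    have h := congrArg (· ᵥ* Q⁻¹) hcol
    simp only [vecMul_vecMul, mul_nonsing_inv _ hdet, vecMul_one, smul_vecMul] at h
    exact (eq_inv_smul_iff₀ hu0.ne').2 h.symm
  have hsum : ∑ i, (Q⁻¹ *ᵥ w) i = u⁻¹ * (u⁻¹ * n) := by
    rw [← one_dotProduct, dotProduct_mulVec, hinv, smul_dotProduct, dotProduct_mulVec, hinv]
    simp
  have hn0 : (n : ℝ) ≠ 0 := by positivity
  change ∑ i, (Q⁻¹ i i - (u / n) * (Q⁻¹ *ᵥ w) i) = _
  rw [Finset.sum_sub_distrib, ← Finset.mul_sum, hsum]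
  congr 1
  field_simp
end
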